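/- arXiv:1708.04632 — 4 statements merged into one kernel-verified Lean document; each statement's English description precedes it below -/
import Mathlib

section
/- Let G be a finite simple graph and let U be the set of vertices u of G such that the connected component of G containing u induces a complete graph. Then μ_α(G) = μ_α(G − U), where G − U is the subgraph of G induced on V(G) ∖ U. -/
/-- `s` is an independent set in `G`: no two vertices of `s` are adjacent. -/
def IndepSet {V : Type*} (G : SimpleGraph V) (s : Set V) : Prop :=
  ∀ ⦃a⦄, a ∈ s → ∀ ⦃b⦄, b ∈ s → ¬ G.Adj a b

/-- `s` is a maximal independent set in `G`. -/
def MaxIndepSet {V : Type*} (G : SimpleGraph V) (s : Set V) : Prop :=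
  IndepSet G s ∧ ∀ t : Set V, IndepSet G t → s ⊆ t → s = t

/-- `α(G)`: the maximum size of an independent set of `G`. -/
noncomputable def alphaNum {V : Type*} (G : SimpleGraph V) : ℕ :=
  sSup {n | ∃ s : Set V, IndepSet G s ∧ s.ncard = n}

/-- `i(G)`: the minimum size of a maximal independent set of `G`. -/
noncomputable def iNum {V : Type*} (G : SimpleGraph V) : ℕ :=
  sInf {n | ∃ s : Set V, MaxIndepSet G s ∧ s.ncard = n}

/-- The independence gap `μ_α(G) = α(G) - i(G)`. -/
noncomputable def indepGap {V : Type*} (G : SimpleGraph V) : ℕ :=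
  alphaNum G - iNum G

/-- `G` is well-covered: all maximal independent sets have the same size. -/
def WellCovered {V : Type*} (G : SimpleGraph V) : Prop :=
  alphaNum G = iNum G

/-- `G` is almost well-covered: its independence gap equals 1. -/
def AlmostWellCovered {V : Type*} (G : SimpleGraph V) : Prop :=
  indepGap G = 1

/-- The (open) neighborhood `N(I)` of a set of vertices `I`. -/
def nbhd {V : Type*} (G : SimpleGraph V) (I : Set V) : Set V :=
  {v | ∃ u ∈ I, G.Adj u v}

/-- `U(G)`: the set of vertices whose connected component induces a complete graph. -/
def completeU {V : Type*} (G : SimpleGraph V) : Set V :=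
  {u | G.IsClique (G.connectedComponentMk u).supp}

/-- A leaf: a vertex of the graph `G - U(G)` having degree 1 there. -/
def IsLeaf {V : Type*} (G : SimpleGraph V) (v : V) : Prop :=
  v ∉ completeU G ∧ {u | u ∉ completeU G ∧ G.Adj v u}.ncard = 1

/-- An internal vertex: a vertex of `G - U(G)` that is not a leaf. -/
def IsInternal {V : Type*} (G : SimpleGraph V) (v : V) : Prop :=
  v ∉ completeU G ∧ ¬ IsLeaf G v

/-- A vertex has type `k` if it is an internal vertex adjacent to exactly `k` leaves;
in addition every vertex of `U(G)` has type `0`. -/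
def HasType {V : Type*} (G : SimpleGraph V) (v : V) (k : ℕ) : Prop :=
  (IsInternal G v ∧ {u | IsLeaf G u ∧ G.Adj v u}.ncard = k) ∨ (v ∈ completeU G ∧ k = 0)

/-- The set of vertices of type `k`; `G_k` is the subgraph induced by this set. -/
def typeSet {V : Type*} (G : SimpleGraph V) (k : ℕ) : Set V :=
  {v | HasType G v k}

/-- The maximum number of vertices in a connected component of `G`. -/
noncomputable def maxCompCard {V : Type*} (G : SimpleGraph V) : ℕ :=
  sSup {n | ∃ c : G.ConnectedComponent, c.supp.ncard = n}

/-- `G` has no cycle of length `n`. -/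
def NoCycleOfLength {V : Type*} (G : SimpleGraph V) (n : ℕ) : Prop :=
  ∀ (v : V) (w : G.Walk v v), w.IsCycle → w.length ≠ n

/-- `G` has girth at least 6: no cycle of length 3, 4, or 5. -/
def GirthAtLeastSix {V : Type*} (G : SimpleGraph V) : Prop :=
  NoCycleOfLength G 3 ∧ NoCycleOfLength G 4 ∧ NoCycleOfLength G 5

/-- A pendant edge: an edge incident with a vertex of degree 1. -/
def pendantEdges {V : Type*} (G : SimpleGraph V) : Set (Sym2 V) :=
  {e | e ∈ G.edgeSet ∧ ∃ v ∈ e, (G.neighborSet v).ncard = 1}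

/-- The pendant edges of `G` are pairwise disjoint and cover every vertex of `G`. -/
def PendantPerfectMatching {V : Type*} (G : SimpleGraph V) : Prop :=
  (∀ e ∈ pendantEdges G, ∀ f ∈ pendantEdges G, e ≠ f → ∀ v : V, v ∈ e → v ∉ f) ∧
  (∀ v : V, ∃ e ∈ pendantEdges G, v ∈ e)

theorem maxIndepSet_iff {V : Type*} {G : SimpleGraph V} {s : Set V} :
    MaxIndepSet G s ↔ IndepSet G s ∧ ∀ v ∉ s, ∃ w ∈ s, G.Adj v w := by
  refine and_congr_right fun hs => ⟨fun h v hv => ?_, fun h t ht hst => ?_⟩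
  · by_contra! hadj
    refine hv ((h (insert v s) ?_ (Set.subset_insert v s)).symm ▸ Set.mem_insert v s)
    rintro a (rfl | ha) b (rfl | hb)
    · exact G.irrefl
    · exact hadj b hb
    · exact fun hab => hadj a ha hab.symm
    · exact hs ha hb
  · refine hst.antisymm fun v hv => ?_
    by_contra hvs
    obtain ⟨w, hw, hvw⟩ := h v hvs
    exact ht hv (hst hw) hvw

theorem bddAbove_indepSet_ncard {V : Type*} [Finite V] (G : SimpleGraph V) :
    BddAbove {n | ∃ s : Set V, IndepSet G s ∧ s.ncard = n} := by
  refine ⟨Nat.card V, ?_⟩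
  rintro _ ⟨s, -, rfl⟩
  exact Set.ncard_le_card s

theorem IndepSet.ncard_le_alphaNum {V : Type*} [Finite V] {G : SimpleGraph V} {s : Set V}
    (hs : IndepSet G s) : s.ncard ≤ alphaNum G :=
  le_csSup (bddAbove_indepSet_ncard G) ⟨s, hs, rfl⟩

theorem exists_indepSet_ncard_eq_alphaNum {V : Type*} [Finite V] (G : SimpleGraph V) :
    ∃ s : Set V, IndepSet G s ∧ s.ncard = alphaNum G :=
  Nat.sSup_mem (s := {n | ∃ s : Set V, IndepSet G s ∧ s.ncard = n})
    ⟨_, ∅, fun _ h => h.elim, rfl⟩ (bddAbove_indepSet_ncard G)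

theorem MaxIndepSet.iNum_le_ncard {V : Type*} {G : SimpleGraph V} {s : Set V}
    (hs : MaxIndepSet G s) : iNum G ≤ s.ncard :=
  Nat.sInf_le ⟨s, hs, rfl⟩

theorem exists_maxIndepSet_ncard_eq_iNum {V : Type*} [Finite V] (G : SimpleGraph V) :
    ∃ s : Set V, MaxIndepSet G s ∧ s.ncard = iNum G := by
  obtain ⟨s, hs, hcard⟩ := exists_indepSet_ncard_eq_alphaNum G
  exact Nat.sInf_mem (s := {n | ∃ s : Set V, MaxIndepSet G s ∧ s.ncard = n})
    ⟨_, s, ⟨hs, fun t ht hst => Set.eq_of_subset_of_ncard_le hst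
      (hcard ▸ ht.ncard_le_alphaNum)⟩, rfl⟩

theorem mem_completeU_iff_of_adj {V : Type*} {G : SimpleGraph V} {u v : V} (h : G.Adj u v) :
    u ∈ completeU G ↔ v ∈ completeU G := by
  simp only [completeU, Set.mem_ofPred_eq,
    SimpleGraph.ConnectedComponent.connectedComponentMk_eq_of_adj h]

theorem adj_of_mem_completeU {V : Type*} {G : SimpleGraph V} {u v : V} (hu : u ∈ completeU G)
    (h : G.connectedComponentMk u = G.connectedComponentMk v) (hne : u ≠ v) : G.Adj u v :=
  hu (SimpleGraph.ConnectedComponent.mem_supp_iff _ _ |>.2 rfl)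
    (SimpleGraph.ConnectedComponent.mem_supp_iff _ _ |>.2 h.symm) hne

theorem IndepSet.injOn_connectedComponentMk {V : Type*} {G : SimpleGraph V} {s : Set V}
    (hs : IndepSet G s) : Set.InjOn G.connectedComponentMk (s ∩ completeU G) := by
  intro a ha b hb hab
  by_contra hne
  exact hs ha.1 hb.1 (adj_of_mem_completeU ha.2 hab hne)

theorem IndepSet.ncard_inter_completeU_le {V : Type*} [Finite V] {G : SimpleGraph V} {s : Set V}
    (hs : IndepSet G s) :
    (s ∩ completeU G).ncard ≤ (G.connectedComponentMk '' completeU G).ncard := by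
  rw [← hs.injOn_connectedComponentMk.ncard_image]
  exact Set.ncard_le_ncard (Set.image_mono Set.inter_subset_right)

theorem MaxIndepSet.ncard_inter_completeU {V : Type*} {G : SimpleGraph V} {s : Set V}
    (hs : MaxIndepSet G s) :
    (s ∩ completeU G).ncard = (G.connectedComponentMk '' completeU G).ncard := by
  rw [← hs.1.injOn_connectedComponentMk.ncard_image]
  congr 1
  refine (Set.image_mono Set.inter_subset_right).antisymm ?_
  rintro _ ⟨u, hu, rfl⟩
  by_cases hus : u ∈ s
  · exact ⟨u, ⟨hus, hu⟩, rfl⟩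
  · obtain ⟨w, hw, huw⟩ := (maxIndepSet_iff.1 hs).2 u hus
    exact ⟨w, ⟨hw, (mem_completeU_iff_of_adj huw).1 hu⟩,
      (SimpleGraph.ConnectedComponent.connectedComponentMk_eq_of_adj huw).symm⟩

theorem IndepSet.preimage_val {V : Type*} {G : SimpleGraph V} {s : Set V} (hs : IndepSet G s)
    (A : Set V) : IndepSet (G.induce A) (Subtype.val ⁻¹' s) :=
  fun _ ha _ hb hab => hs ha hb hab

theorem MaxIndepSet.preimage_val_compl_completeU {V : Type*} {G : SimpleGraph V} {s : Set V}
    (hs : MaxIndepSet G s) :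
    MaxIndepSet (G.induce (completeU G)ᶜ) (Subtype.val ⁻¹' s) := by
  refine maxIndepSet_iff.2 ⟨hs.1.preimage_val _, fun v hv => ?_⟩
  obtain ⟨w, hw, hvw⟩ := (maxIndepSet_iff.1 hs).2 v hv
  exact ⟨⟨w, fun h => v.2 ((mem_completeU_iff_of_adj hvw).2 h)⟩, hw, hvw⟩

theorem ncard_inter_add_ncard_preimage_val_compl {V : Type*} [Finite V] (s U : Set V) :
    (Subtype.val ⁻¹' s : Set ↥Uᶜ).ncard + (s ∩ U).ncard = s.ncard := by
  rw [← Set.ncard_image_of_injective _ Subtype.val_injective, Subtype.image_preimage_coe,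
    ← Set.sdiff_eq_compl_inter, add_comm,
    Set.ncard_inter_add_ncard_sdiff_eq_ncard]

/-- An independent set of `G - U(G)` extends to `G` by one vertex from each complete component,
and the extension preserves maximality. -/
theorem IndepSet.exists_extend_completeU {V : Type*} [Finite V] {G : SimpleGraph V}
    {t : Set ↥(completeU G)ᶜ} (ht : IndepSet (G.induce (completeU G)ᶜ) t) :
    ∃ s : Set V, IndepSet G s ∧
      s.ncard = t.ncard + (G.connectedComponentMk '' completeU G).ncard ∧
      (MaxIndepSet (G.induce (completeU G)ᶜ) t → MaxIndepSet G s) := by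
  obtain ⟨T, hTU, hT⟩ := Set.SurjOn.exists_bijOn_subset
    (Set.surjOn_image G.connectedComponentMk (completeU G))
  have hs : IndepSet G (Subtype.val '' t ∪ T) := by
    rintro a (⟨a, ha, rfl⟩ | ha) b (⟨b, hb, rfl⟩ | hb) hab
    · exact ht ha hb hab
    · exact a.2 ((mem_completeU_iff_of_adj hab).2 (hTU hb))
    · exact b.2 ((mem_completeU_iff_of_adj hab).1 (hTU ha))
    · exact hab.ne (hT.injOn ha hb
        (SimpleGraph.ConnectedComponent.connectedComponentMk_eq_of_adj hab))
  refine ⟨_, hs, ?_, fun hmax => maxIndepSet_iff.2 ⟨hs, fun v hv => ?_⟩⟩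
  · rw [Set.ncard_union_eq, Set.ncard_image_of_injective _ Subtype.val_injective, ← hT.image_eq,
      hT.injOn.ncard_image]
    rw [Set.disjoint_left]
    rintro _ ⟨a, -, rfl⟩ ha
    exact a.2 (hTU ha)
  · by_cases hvU : v ∈ completeU G
    · obtain ⟨w, hw, hwv⟩ := hT.surjOn (Set.mem_image_of_mem _ hvU)
      refine ⟨w, Or.inr hw, adj_of_mem_completeU hvU hwv.symm ?_⟩
      rintro rfl
      exact hv (Or.inr hw)
    · obtain ⟨w, hw, hvw⟩ := (maxIndepSet_iff.1 hmax).2 ⟨v, hvU⟩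
        fun h => hv (Or.inl ⟨_, h, rfl⟩)
      exact ⟨w, Or.inl ⟨w, hw, rfl⟩, hvw⟩

theorem alphaNum_eq_add_ncard_complete_components {V : Type*} [Finite V] (G : SimpleGraph V) :
    alphaNum G = alphaNum (G.induce (completeU G)ᶜ) +
      (G.connectedComponentMk '' completeU G).ncard := by
  apply le_antisymm
  · obtain ⟨s, hs, hcard⟩ := exists_indepSet_ncard_eq_alphaNum G
    rw [← hcard, ← ncard_inter_add_ncard_preimage_val_compl s (completeU G)]
    exact add_le_add (hs.preimage_val _).ncard_le_alphaNum hs.ncard_inter_completeU_le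
  · obtain ⟨t, ht, hcard⟩ := exists_indepSet_ncard_eq_alphaNum (G.induce (completeU G)ᶜ)
    obtain ⟨s, hs, hst, -⟩ := ht.exists_extend_completeU
    rw [← hcard, ← hst]
    exact hs.ncard_le_alphaNum

theorem iNum_eq_add_ncard_complete_components {V : Type*} [Finite V] (G : SimpleGraph V) :
    iNum G = iNum (G.induce (completeU G)ᶜ) +
      (G.connectedComponentMk '' completeU G).ncard := by
  apply le_antisymm
  · obtain ⟨t, ht, hcard⟩ := exists_maxIndepSet_ncard_eq_iNum (G.induce (completeU G)ᶜ)
    obtain ⟨s, -, hst, hs⟩ := ht.1.exists_extend_completeU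
    rw [← hcard, ← hst]
    exact (hs ht).iNum_le_ncard
  · obtain ⟨s, hs, hcard⟩ := exists_maxIndepSet_ncard_eq_iNum G
    rw [← hcard, ← ncard_inter_add_ncard_preimage_val_compl s (completeU G),
      hs.ncard_inter_completeU]
    exact Nat.add_le_add_right hs.preimage_val_compl_completeU.iNum_le_ncard _

/-- Removing all vertices lying in complete components does not change the
independence gap. -/
theorem indepGap_remove_complete_components {V : Type*} [Fintype V] (G : SimpleGraph V) :
    indepGap G = indepGap (G.induce (completeU G)ᶜ) := by
  rw [indepGap, indepGap, alphaNum_eq_add_ncard_complete_components G,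
    iNum_eq_add_ncard_complete_components G, Nat.add_sub_add_right]
end

section
/- For every finite simple graph G and every independent set I of G, μ_α(G − N[I]) ≤ μ_α(G), where N[I] = N(I) ∪ I is the closed neighborhood of I and G − N[I] is the subgraph of G induced on V(G) ∖ N[I]. -/
theorem IndepSet.maxIndepSet_of_ncard_eq {V : Type*} [Finite V] {G : SimpleGraph V} {s : Set V}
    (hs : IndepSet G s) (hcard : s.ncard = alphaNum G) : MaxIndepSet G s :=
  ⟨hs, fun t ht hst => Set.eq_of_subset_of_ncard_le hst (hcard ▸ ht.ncard_le_alphaNum)⟩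

theorem ncard_image_val_union {V : Type*} [Finite V] (G : SimpleGraph V) (I : Set V)
    (s : Set ↥(nbhd G I ∪ I)ᶜ) : (Subtype.val '' s ∪ I).ncard = s.ncard + I.ncard := by
  rw [Set.ncard_union_eq, Set.ncard_image_of_injective _ Subtype.val_injective]
  rw [Set.disjoint_left]
  rintro _ ⟨x, -, rfl⟩ hx
  exact x.2 (Or.inr hx)

theorem IndepSet.image_val_union {V : Type*} {G : SimpleGraph V} {I : Set V}
    (hI : IndepSet G I) {s : Set ↥(nbhd G I ∪ I)ᶜ}
    (hs : IndepSet (G.induce (nbhd G I ∪ I)ᶜ) s) : IndepSet G (Subtype.val '' s ∪ I) := by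
  rintro _ (⟨x, hx, rfl⟩ | ha) _ (⟨y, hy, rfl⟩ | hb) hadj
  · exact hs hx hy hadj
  · exact x.2 (Or.inl ⟨_, hb, hadj.symm⟩)
  · exact y.2 (Or.inl ⟨_, ha, hadj⟩)
  · exact hI ha hb hadj

theorem MaxIndepSet.image_val_union {V : Type*} {G : SimpleGraph V} {I : Set V}
    (hI : IndepSet G I) {s : Set ↥(nbhd G I ∪ I)ᶜ}
    (hs : MaxIndepSet (G.induce (nbhd G I ∪ I)ᶜ) s) :
    MaxIndepSet G (Subtype.val '' s ∪ I) := by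
  refine ⟨hI.image_val_union hs.1, fun t ht hst => hst.antisymm fun v hv => ?_⟩
  by_cases hvI : v ∈ I
  · exact Or.inr hvI
  have hvc : v ∈ (nbhd G I ∪ I)ᶜ := by
    rintro (⟨u, hu, huv⟩ | h)
    · exact ht (hst (Or.inr hu)) hv huv
    · exact hvI h
  have hst' : s = Subtype.val ⁻¹' t :=
    hs.2 _ (fun a ha b hb hab => ht ha hb hab) fun x hx => hst (Or.inl ⟨x, hx, rfl⟩)
  exact Or.inl ⟨⟨v, hvc⟩, by rw [hst']; exact hv, rfl⟩

/-- For every independent set `I` of `G`,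
`μ_α(G − N[I]) ≤ μ_α(G)` where `N[I] = N(I) ∪ I`. -/
theorem indepGap_remove_closed_neighborhood {V : Type*} [Fintype V] (G : SimpleGraph V)
    (I : Set V) (hI : IndepSet G I) :
    indepGap (G.induce (nbhd G I ∪ I)ᶜ) ≤ indepGap G := by
  obtain ⟨s, hs, hsα⟩ := exists_indepSet_ncard_eq_alphaNum (G.induce (nbhd G I ∪ I)ᶜ)
  obtain ⟨t, ht, hti⟩ := exists_maxIndepSet_ncard_eq_iNum (G.induce (nbhd G I ∪ I)ᶜ)
  have hα := (hI.image_val_union hs).ncard_le_alphaNum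
  have hi := (MaxIndepSet.image_val_union hI ht).iNum_le_ncard
  rw [ncard_image_val_union] at hα hi
  unfold indepGap
  omega
end

section
/- Let k ≥ 0 be an integer and let G be a finite simple graph with μ_α(G) ≤ k. Then every vertex of G is adjacent to at most k+1 vertices of degree 1. -/
theorem IndepSet.exists_maxIndepSet_superset {V : Type*} [Finite V] {G : SimpleGraph V}
    {s : Set V} (hs : IndepSet G s) : ∃ t, s ⊆ t ∧ MaxIndepSet G t := by
  obtain ⟨t, hst, ht⟩ := (Set.toFinite {t : Set V | IndepSet G t}).exists_le_maximal hs
  exact ⟨t, hst, ht.prop, fun u hu htu => ht.eq_of_subset hu htu⟩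

/-- Replacing `v` in an independent set by all its neighbors of degree 1 keeps the set
independent. -/
theorem IndepSet.diff_union_degree_one {V : Type*} {G : SimpleGraph V} {s : Set V}
    (hs : IndepSet G s) (v : V) :
    IndepSet G (s \ {v} ∪ {u | G.Adj v u ∧ (G.neighborSet u).ncard = 1}) := by
  have eq_of_adj : ∀ ⦃a b⦄, G.Adj v a ∧ (G.neighborSet a).ncard = 1 → G.Adj a b → b = v := by
    rintro a b ⟨hva, ha⟩ hab
    obtain ⟨x, hx⟩ := Set.ncard_eq_one.mp ha
    have hb : b ∈ G.neighborSet a := hab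
    have hv : v ∈ G.neighborSet a := hva.symm
    rw [hx] at hb hv
    exact hb.trans hv.symm
  rintro a (⟨has, hav⟩ | ha) b (⟨hbs, hbv⟩ | hb) hab
  · exact hs has hbs hab
  · exact hav (eq_of_adj hb hab.symm)
  · exact hbv (eq_of_adj ha hab)
  · exact hb.1.ne (eq_of_adj ha hab).symm

/-- If `μ_α(G) ≤ k`, then every vertex of `G` is adjacent to at most
`k + 1` vertices of degree 1. -/
theorem adj_degree_one_le_gap_succ {V : Type*} [Fintype V] (G : SimpleGraph V) (k : ℕ)
    (h : indepGap G ≤ k) (v : V) :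
    {u | G.Adj v u ∧ (G.neighborSet u).ncard = 1}.ncard ≤ k + 1 := by
  have hv : IndepSet G {v} := by
    rintro a rfl b rfl
    exact G.irrefl
  obtain ⟨s, hvs, hs⟩ := hv.exists_maxIndepSet_superset
  have hvs : v ∈ s := hvs rfl
  have hdisj : Disjoint (s \ {v}) {u | G.Adj v u ∧ (G.neighborSet u).ncard = 1} :=
    Set.disjoint_left.mpr fun u hu hvu => hs.1 hvs hu.1 hvu.1
  have hα := (hs.1.diff_union_degree_one v).ncard_le_alphaNum
  rw [Set.ncard_union_eq hdisj] at hα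
  have hcard := Set.ncard_sdiff_singleton_add_one hvs
  have hi := hs.iNum_le_ncard
  unfold indepGap at h
  omega
end

section
/- Let G be an almost well-covered finite simple graph. Then any two distinct vertices of G, each of which is adjacent to exactly two vertices of degree 1, are adjacent; that is, the set of vertices adjacent to exactly two degree-1 vertices forms a clique in G. -/
theorem eq_of_adj_of_ncard_neighborSet_eq_one {V : Type*} {G : SimpleGraph V} {u v w : V}
    (hu : (G.neighborSet u).ncard = 1) (hv : G.Adj u v) (hw : G.Adj u w) : v = w := by
  obtain ⟨z, hz⟩ := Set.ncard_eq_one.mp hu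
  have mem_eq : ∀ {a}, G.Adj u a → a = z := fun {a} ha => by
    have : a ∈ G.neighborSet u := ha
    rwa [hz] at this
  exact (mem_eq hv).trans (mem_eq hw).symm

/-- In an almost well-covered graph, the set of vertices adjacent to exactly
two degree-1 vertices forms a clique. -/
theorem type2_vertices_clique {V : Type*} [Fintype V] (G : SimpleGraph V)
    (h : AlmostWellCovered G) :
    G.IsClique {v | {u | G.Adj v u ∧ (G.neighborSet u).ncard = 1}.ncard = 2} := by
  intro x hx y hy hxy
  by_contra hadj
  have hpair : IndepSet G {x, y} := by
    rintro a (rfl | rfl) b (rfl | rfl) hab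
    exacts [G.irrefl hab, hadj hab, hadj hab.symm, G.irrefl hab]
  obtain ⟨s, hs, hmax⟩ := hpair.exists_maxIndepSet_superset
  have hxs : x ∈ s := hs (by simp)
  have hys : y ∈ s := hs (by simp)
  set A := {u | G.Adj x u ∧ (G.neighborSet u).ncard = 1}
  set B := {u | G.Adj y u ∧ (G.neighborSet u).ncard = 1}
  have hA2 : A.ncard = 2 := hx
  have hB2 : B.ncard = 2 := hy
  have hAB : Disjoint A B := Set.disjoint_left.mpr fun u hu hu' =>
    hxy (eq_of_adj_of_ncard_neighborSet_eq_one hu.2 hu.1.symm hu'.1.symm)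
  have hnbr : ∀ {u v}, u ∈ A ∪ B → G.Adj u v → v = x ∨ v = y := by
    rintro u v (hu | hu) huv
    · exact .inl (eq_of_adj_of_ncard_neighborSet_eq_one hu.2 huv hu.1.symm)
    · exact .inr (eq_of_adj_of_ncard_neighborSet_eq_one hu.2 huv hu.1.symm)
  have hsAB : Disjoint s (A ∪ B) := by
    refine Set.disjoint_left.mpr ?_
    rintro u hus (hu | hu)
    exacts [hmax.1 hxs hus hu.1, hmax.1 hys hus hu.1]
  have hnot : ∀ {v}, v ∈ s \ {x, y} ∪ (A ∪ B) → ¬ (v = x ∨ v = y) := by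
    rintro v (hv | hv) hvxy
    · exact hv.2 hvxy
    · refine Set.disjoint_left.mp hsAB ?_ hv
      rcases hvxy with rfl | rfl <;> assumption
  have hindep : IndepSet G (s \ {x, y} ∪ (A ∪ B)) := by
    intro a ha b hb hab
    rcases ha with ha' | ha'
    · rcases hb with hb' | hb'
      · exact hmax.1 ha'.1 hb'.1 hab
      · exact hnot (.inl ha') (hnbr hb' hab.symm)
    · exact hnot hb (hnbr ha' hab)
  have hcard : (s \ {x, y} ∪ (A ∪ B)).ncard = (s \ {x, y}).ncard + 4 := by
    rw [Set.ncard_union_eq (hsAB.mono_left Set.sdiff_subset), Set.ncard_union_eq hAB, hA2, hB2]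
  have hdiff : (s \ {x, y}).ncard + 2 = s.ncard := by
    rw [← Set.ncard_pair hxy, Set.ncard_sdiff_add_ncard_of_subset hs]
  have hle := hindep.ncard_le_alphaNum
  have hge := hmax.iNum_le_ncard
  have hgap : alphaNum G - iNum G = 1 := h
  omega
end
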